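/- For every n ≥ 2, the reciprocal of the big ascent polynomial B_n(x) = Σ_{π ∈ S_n} x^{basc(π)} is bi-γ-positive: there exist nonnegative real numbers a_j (0 ≤ j ≤ ⌊(n−2)/2⌋) and b_j (0 ≤ j ≤ ⌊(n−3)/2⌋) such that Σ_{π ∈ S_n} x^{n−2−basc(π)} = Σ_j a_j x^j (1+x)^{n−2−2j} + Σ_j b_j x^{j+1} (1+x)^{n−3−2j}. Consequently, writing B_n(x) = Σ_{k=0}^{n−2} c_k x^k, the coefficient sequence is spiral: c_{n−2} ≤ c_0 ≤ c_{n−3} ≤ c_1 ≤ ⋯ ≤ c_{⌊(n−2)/2⌋}. -/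

import Mathlib

open Finset

namespace SucEuler

/-- One-line notation word of a permutation: `word π i` is the value (in `1..n`)
at position `i ∈ {1,…,n}`, and `0` for positions outside `{1,…,n}`
(this implements the conventions `π(0)=π(n+1)=0`). -/
def word {n : ℕ} (π : Equiv.Perm (Fin n)) (i : ℕ) : ℕ :=
  if h : 1 ≤ i ∧ i ≤ n then ((π ⟨i - 1, by omega⟩ : Fin n) : ℕ) + 1 else 0

/-- number of descents -/
def des {n : ℕ} (π : Equiv.Perm (Fin n)) : ℕ :=
  ((Finset.Icc 1 (n - 1)).filter fun i => word π (i + 1) < word π i).card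

/-- number of ascents -/
def asc {n : ℕ} (π : Equiv.Perm (Fin n)) : ℕ :=
  ((Finset.Icc 1 (n - 1)).filter fun i => word π i < word π (i + 1)).card

/-- number of successions -/
def suc {n : ℕ} (π : Equiv.Perm (Fin n)) : ℕ :=
  ((Finset.Icc 1 (n - 1)).filter fun i => word π (i + 1) = word π i + 1).card

/-- number of big ascents -/
def basc {n : ℕ} (π : Equiv.Perm (Fin n)) : ℕ :=
  ((Finset.Icc 1 (n - 1)).filter fun i => word π i + 2 ≤ word π (i + 1)).card

/-- number of excedances -/
def excStat {n : ℕ} (σ : Equiv.Perm (Fin n)) : ℕ :=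
  (Finset.univ.filter fun i : Fin n => i < σ i).card

/-- number of fixed points -/
def fixStat {n : ℕ} (σ : Equiv.Perm (Fin n)) : ℕ :=
  (Finset.univ.filter fun i : Fin n => σ i = i).card

/-- number of drops -/
def dropStat {n : ℕ} (σ : Equiv.Perm (Fin n)) : ℕ :=
  (Finset.univ.filter fun i : Fin n => σ i < i).card

/-- number of excedances at positions `i ≥ 2` -/
def excHat {n : ℕ} (σ : Equiv.Perm (Fin n)) : ℕ :=
  (Finset.univ.filter fun i : Fin n => 0 < (i : ℕ) ∧ i < σ i).card

/-- number of fixed points other than `1` -/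
def fixHat {n : ℕ} (σ : Equiv.Perm (Fin n)) : ℕ :=
  (Finset.univ.filter fun i : Fin n => 0 < (i : ℕ) ∧ σ i = i).card

/-- number of cycles (orbits) of a permutation -/
def cyc {n : ℕ} (σ : Equiv.Perm (Fin n)) : ℕ :=
  σ.cycleType.card + fixStat σ

/-- number of cycle double ascents: values `x` with `σ⁻¹(x) < x < σ(x)` -/
def cda {n : ℕ} (σ : Equiv.Perm (Fin n)) : ℕ :=
  (Finset.univ.filter fun x : Fin n => σ⁻¹ x < x ∧ x < σ x).card

open Classical in
/-- number of left-to-right minima -/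
noncomputable def lrmin {n : ℕ} (π : Equiv.Perm (Fin n)) : ℕ :=
  ((Finset.Icc 1 n).filter fun i => ∀ j ∈ Finset.Icc 1 n, j < i → word π i < word π j).card

open Classical in
/-- number of proper left-to-right minima -/
noncomputable def plrmin {n : ℕ} (π : Equiv.Perm (Fin n)) : ℕ :=
  ((Finset.Icc 1 n).filter fun i =>
    (∀ j ∈ Finset.Icc 1 n, j < i → word π i < word π j) ∧ word π i ≠ 1 ∧
      ∃ k ∈ Finset.Icc 1 n, i < k ∧ word π k = word π i - 1 ∧ word π (k + 1) < word π k).card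

open Classical in
/-- number of simsun successions -/
noncomputable def simsuc {n : ℕ} (π : Equiv.Perm (Fin n)) : ℕ :=
  ((Finset.Icc 1 n).filter fun i =>
    ∃ j ∈ Finset.Icc 1 n, i < j ∧ word π j = word π i + 1 ∧
      ∀ k ∈ Finset.Icc 1 n, i < k → k < j → word π i + 1 < word π k).card

/-- number of peaks (with the boundary conventions `π(0)=π(n+1)=0`) -/
def pk {n : ℕ} (π : Equiv.Perm (Fin n)) : ℕ :=
  ((Finset.Icc 1 n).filter fun i => word π (i - 1) < word π i ∧ word π (i + 1) < word π i).card

/-- number of valleys -/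
def valStat {n : ℕ} (π : Equiv.Perm (Fin n)) : ℕ :=
  ((Finset.Icc 1 n).filter fun i => word π i < word π (i - 1) ∧ word π i < word π (i + 1)).card

/-- number of double ascents -/
def dasc {n : ℕ} (π : Equiv.Perm (Fin n)) : ℕ :=
  ((Finset.Icc 1 n).filter fun i => word π (i - 1) < word π i ∧ word π i < word π (i + 1)).card

/-- number of double descents -/
def ddes {n : ℕ} (π : Equiv.Perm (Fin n)) : ℕ :=
  ((Finset.Icc 1 n).filter fun i => word π (i + 1) < word π i ∧ word π i < word π (i - 1)).card

open Classical in
/-- `nextVal σ m x` is the (0-indexed) first value `≤ m` (i.e. `< m` in 0-indexed terms)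
in the forward orbit of `x` under `σ`: it equals `σ^t(x)` for the minimal `t ≥ 1`
with `σ^t(x) < m`, when such `t` exists. This is the action of the permutation `σ_k`
(with `m = n - k`) obtained by removing the `k` largest letters from the cycles of `σ`. -/
noncomputable def nextVal {n : ℕ} (σ : Equiv.Perm (Fin n)) (m : ℕ) (x : Fin n) : ℕ :=
  if h : ∃ t : ℕ, 0 < t ∧ (((σ ^ t) x : Fin n) : ℕ) < m then (((σ ^ Nat.find h) x : Fin n) : ℕ)
  else 0

/-- `σ` is a simsun permutation of the second kind: for every `0 ≤ k ≤ n-1`, the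
permutation of `[n-k]` obtained from `σ` by removing the `k` largest letters has
no cycle double ascents. (Here `m = n - k` and values are 0-indexed.) -/
def IsSimsun2 {n : ℕ} (σ : Equiv.Perm (Fin n)) : Prop :=
  ∀ m ≤ n, ∀ x : Fin n, (x : ℕ) < m →
    ¬ (nextVal σ⁻¹ m x < (x : ℕ) ∧ (x : ℕ) < nextVal σ m x)

noncomputable instance {n : ℕ} : DecidablePred (IsSimsun2 (n := n)) :=
  fun _ => Classical.propDecidable _

/-- the derangement polynomial `d_n(x)` -/
def dpoly (n : ℕ) (x : ℝ) : ℝ :=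
  ∑ σ ∈ Finset.univ.filter fun σ : Equiv.Perm (Fin n) => fixStat σ = 0, x ^ excStat σ

/-- the Eulerian polynomial `A_n(x)` -/
def eulerian (n : ℕ) (x : ℝ) : ℝ :=
  ∑ π : Equiv.Perm (Fin n), x ^ des π


/-- the number of permutations of `[n]` with exactly `k` big ascents, i.e. the
coefficient `c_k` of the big ascent polynomial `B_n(x)` -/
def bascCount (n k : ℕ) : ℕ :=
  (Finset.univ.filter fun π : Equiv.Perm (Fin n) => basc π = k).card


open Polynomial in
/-- cone of gamma-positive polynomials of center `(m - s)/2` -/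
inductive Gam (s m : ℕ) : ℝ[X] → Prop
  | zero : Gam s m 0
  | step (f : ℝ[X]) (c : ℝ) (j e : ℕ) (hf : Gam s m f) (hc : 0 ≤ c) (h : e + 2 * j + s = m) :
      Gam s m (f + C c * (X ^ j * (1 + X) ^ e))

section
open Polynomial

theorem Gam.add {s m : ℕ} {f g : ℝ[X]} (hf : Gam s m f) (hg : Gam s m g) : Gam s m (f + g) := by
  induction hg with
  | zero => simpa using hf
  | step g c j e _ hc h ih =>
    rw [← add_assoc]
    exact Gam.step _ c j e ih hc h

theorem Gam.single {s m : ℕ} (c : ℝ) (j e : ℕ) (hc : 0 ≤ c) (h : e + 2 * j + s = m) :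
    Gam s m (C c * (X ^ j * (1 + X) ^ e)) := by
  simpa using Gam.step 0 c j e Gam.zero hc h

theorem Gam.shift {m : ℕ} {f : ℝ[X]} (hf : Gam 0 m f) : Gam 1 (m + 1) f := by
  induction hf with
  | zero => exact Gam.zero
  | step g c j e _ hc h ih => exact Gam.step _ c j e ih hc (by omega)

noncomputable def T (p q : ℝ) (f : ℝ[X]) : ℝ[X] :=
  (C p + C q * X) * f + X * (1 - X) * derivative f

theorem T_add (p q : ℝ) (f g : ℝ[X]) : T p q (f + g) = T p q f + T p q g := by
  simp only [T, derivative_add]; ring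

theorem T_single (al c : ℝ) (j e : ℕ) :
    T al (e + 2 * j + al) (C c * (X ^ j * (1 + X) ^ e)) =
      C (c * (al + j)) * (X ^ j * (1 + X) ^ (e + 1)) +
        C (c * (2 * e)) * (X ^ (j + 1) * (1 + X) ^ (e - 1)) := by
  have hj : X * derivative (X ^ j : ℝ[X]) = C (j : ℝ) * X ^ j := by
    cases j with
    | zero => simp
    | succ k => rw [derivative_X_pow]; simp; ring
  have he : derivative ((1 + X) ^ e : ℝ[X]) = C (e : ℝ) * (1 + X) ^ (e - 1) := by
    rw [derivative_pow]; simp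
  have he2 : C (e : ℝ) * (1 + X) ^ e = C (e : ℝ) * ((1 + X) ^ (e - 1) * (1 + X) : ℝ[X]) := by
    cases e with
    | zero => simp
    | succ k => simp [pow_succ]
  simp only [T, derivative_mul, derivative_C, zero_mul, zero_add, he]
  simp only [map_add, map_mul, map_ofNat, map_natCast] at *
  rw [pow_succ, pow_succ]
  linear_combination (C c * (1 - X) * (1 + X) ^ e) * hj + C c * X ^ j * X * he2

theorem Gam.T {s m : ℕ} {f : ℝ[X]} (al : ℝ) (hal : 0 ≤ al) (hf : Gam s m f) :
    Gam s (m + 1) (T al (m - s + al) f) := by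
  induction hf with
  | zero => simpa [SucEuler.T] using Gam.zero
  | step g c j e _ hc h ih =>
    rw [T_add]
    refine ih.add ?_
    have : (m : ℝ) - s + al = e + 2 * j + al := by rw [← h]; push_cast; ring
    rw [this, T_single]
    refine Gam.add (Gam.single _ _ _ (by positivity) (by omega)) ?_
    cases e with
    | zero => simpa using Gam.zero
    | succ k => exact Gam.single _ _ _ (by positivity) (by simp; omega)

theorem Gam.explicit {s m : ℕ} {f : ℝ[X]} (hf : Gam s m f) :
    ∃ a : ℕ → ℝ, (∀ j, 0 ≤ a j) ∧ ∀ x : ℝ, f.eval x =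
      ∑ j ∈ Finset.range ((m - s) / 2 + 1), a j * x ^ j * (1 + x) ^ (m - s - 2 * j) := by
  induction hf with
  | zero => exact ⟨fun _ => 0, by simp, by simp⟩
  | step g c j e _ hc h ih =>
    obtain ⟨a, ha, hx⟩ := ih
    refine ⟨fun i => a i + if i = j then c else 0, fun i => ?_, fun x => ?_⟩
    · have := ha i
      dsimp only
      split_ifs <;> linarith
    · simp only [add_mul, Finset.sum_add_distrib, eval_add, hx]
      congr 1
      rw [Finset.sum_eq_single j]
      · have : m - s - 2 * j = e := by omega
        simp [this]; ring
      · intro b _ hb; simp [hb]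
      · intro hb; exact absurd (Finset.mem_range.2 (by omega)) hb

theorem reflect_one_add (e : ℕ) : reflect e ((1 + X : ℝ[X]) ^ e) = (1 + X) ^ e := by
  induction e with
  | zero => simp
  | succ k ih =>
    have h1 : ((1 + X : ℝ[X]) ^ k).natDegree ≤ k := by
      refine natDegree_pow_le.trans ?_
      have : (1 + X : ℝ[X]).natDegree ≤ 1 := by compute_degree
      nlinarith
    rw [pow_succ, reflect_mul _ _ h1 (by compute_degree), ih]
    congr 1
    rw [reflect_add, reflect_one, reflect_one_X, add_comm]; simp

theorem Gam.reflect {s m : ℕ} {f : ℝ[X]} (hf : Gam s m f) : reflect m f = X ^ s * f := by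
  induction hf with
  | zero => simp
  | step g c j e _ hc h ih =>
    rw [reflect_add, ih, reflect_C_mul]
    have h1 : ((1 + X : ℝ[X]) ^ e).natDegree ≤ e := by
      refine natDegree_pow_le.trans ?_
      have : (1 + X : ℝ[X]).natDegree ≤ 1 := by compute_degree
      nlinarith
    have h2 : m = (2 * j + s) + e := by omega
    have h3 : Polynomial.reflect m (X ^ j * (1 + X) ^ e : ℝ[X]) = X ^ (j + s) * (1 + X) ^ e := by
      rw [h2, reflect_mul _ _ (by rw [natDegree_X_pow]; omega) h1, reflect_one_add, reflect_monomial,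
        revAt_le (by omega)]
      congr 2; omega
    rw [h3]; ring

theorem choose_mono_half (e r : ℕ) (h : 2 * r + 1 ≤ e) : e.choose r ≤ e.choose (r + 1) := by
  rcases Nat.lt_or_ge (2 * r + 1) e with h1 | h1
  · exact Nat.choose_le_succ_of_lt_half_left (by omega)
  · exact (Nat.choose_symm_of_eq_add (by omega)).le

theorem Gam.coeff_mono {s m : ℕ} {f : ℝ[X]} (hf : Gam s m f) (i : ℕ) (hi : 2 * i + 1 + s ≤ m) :
    f.coeff i ≤ f.coeff (i + 1) := by
  induction hf with
  | zero => simp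
  | step g c j e _ hc h ih =>
    simp only [coeff_add, coeff_C_mul]
    refine add_le_add ih (mul_le_mul_of_nonneg_left ?_ hc)
    rw [coeff_X_pow_mul', coeff_X_pow_mul']
    simp only [coeff_one_add_X_pow]
    split_ifs with h1 h2 h2
    · rw [show i + 1 - j = i - j + 1 by omega]
      exact_mod_cast choose_mono_half _ _ (by omega)
    · omega
    · positivity
    · exact le_rfl


theorem Gam.coeff_nonneg {s m : ℕ} {f : ℝ[X]} (hf : Gam s m f) (i : ℕ) : 0 ≤ f.coeff i := by
  induction hf with
  | zero => simp
  | step g c j e _ hc h ih =>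
    simp only [coeff_add, coeff_C_mul]
    refine add_nonneg ih (mul_nonneg hc ?_)
    rw [coeff_X_pow_mul']
    simp only [coeff_one_add_X_pow]
    split_ifs <;> positivity


def ins {m : ℕ} (p : Fin (m + 1)) (π : Equiv.Perm (Fin m)) : Equiv.Perm (Fin (m + 1)) :=
  ((finSuccEquiv' p).trans (Equiv.optionCongr π)).trans (finSuccEquiv' (Fin.last m)).symm

theorem ins_at {m : ℕ} (p : Fin (m + 1)) (π : Equiv.Perm (Fin m)) : ins p π p = Fin.last m := by
  simp [ins]

theorem ins_succAbove {m : ℕ} (p : Fin (m + 1)) (π : Equiv.Perm (Fin m)) (i : Fin m) :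
    ins p π (p.succAbove i) = (π i).castSucc := by
  simp [ins]

theorem ins_bij {m : ℕ} :
    Function.Bijective (fun q : Equiv.Perm (Fin m) × Fin (m + 1) => ins q.2 q.1) := by
  rw [Fintype.bijective_iff_injective_and_card]
  constructor
  · rintro ⟨π, p⟩ ⟨τ, q⟩ h
    dsimp only at h
    have hp : p = q := by
      apply (ins q τ).injective
      rw [ins_at, ← h, ins_at]
    subst hp
    congr 1
    ext i
    have := congrArg (fun g => g (p.succAbove i)) h
    simp only [ins_succAbove] at this
    exact congrArg Fin.val (Fin.castSucc_injective _ this)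
  · simp [Fintype.card_perm, Nat.factorial_succ, mul_comm]

theorem word_ins {m : ℕ} (p : Fin (m + 1)) (π : Equiv.Perm (Fin m)) (i : ℕ) :
    word (ins p π) i = if i ≤ p then word π i else if i = p + 1 then m + 1 else word π (i - 1) := by
  have hp := p.2
  split_ifs with h1 h2
  · unfold word
    by_cases h0 : 1 ≤ i
    · rw [dif_pos ⟨h0, by omega⟩, dif_pos ⟨h0, by omega⟩]
      have : (⟨i - 1, by omega⟩ : Fin (m + 1)) = p.succAbove ⟨i - 1, by omega⟩ := by
        rw [Fin.succAbove_of_castSucc_lt]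
        · rfl
        · rw [Fin.lt_def]; simp; omega
      rw [this, ins_succAbove]; simp
    · rw [dif_neg (by omega), dif_neg (by omega)]
  · unfold word
    rw [dif_pos (by omega)]
    have : (⟨i - 1, by omega⟩ : Fin (m + 1)) = p := by ext; simp; omega
    rw [this, ins_at]; simp
  · unfold word
    by_cases h0 : i ≤ m + 1
    · rw [dif_pos (by omega), dif_pos (by omega)]
      have : (⟨i - 1, by omega⟩ : Fin (m + 1)) = p.succAbove ⟨i - 1 - 1, by omega⟩ := by
        rw [Fin.succAbove_of_le_castSucc]
        · ext; simp; omega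
        · rw [Fin.le_def]; simp; omega
      rw [this, ins_succAbove]; simp
    · rw [dif_neg (by omega), dif_neg (by omega)]

theorem word_le {m : ℕ} (π : Equiv.Perm (Fin m)) (i : ℕ) : word π i ≤ m := by
  unfold word; split_ifs
  · exact (π _).2
  · omega

def bset {m : ℕ} (π : Equiv.Perm (Fin m)) : Finset ℕ :=
  (Finset.Icc 1 (m - 1)).filter fun i => word π i + 2 ≤ word π (i + 1)

/-- insertion slots that do not change the number of big ascents -/
def good {m : ℕ} (π : Equiv.Perm (Fin m)) : Finset ℕ :=
  (Finset.range (m + 1)).filter fun p => p = 0 ∨ word π p = m ∨ p ∈ bset π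

theorem card_good {m : ℕ} (hm : 1 ≤ m) (π : Equiv.Perm (Fin m)) : (good π).card = basc π + 2 := by
  let q : ℕ := (π.symm ⟨m - 1, by omega⟩ : Fin m) + 1
  have hq : q ≤ m := (π.symm ⟨m - 1, by omega⟩).2
  have hq1 : 1 ≤ q := by omega
  have hw : ∀ p, word π p = m ↔ p = q := by
    intro p
    constructor
    · intro h
      unfold word at h
      split_ifs at h with h1
      · have : π ⟨p - 1, by omega⟩ = ⟨m - 1, by omega⟩ := by ext; simp; omega
        have h2 := (π.symm_apply_eq.2 this.symm)
        have h3 := congrArg Fin.val h2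
        simp only at h3
        omega
      · omega
    · intro h
      subst h
      unfold word
      rw [dif_pos ⟨hq1, hq⟩]
      simp [q]; omega
  have hg : good π = insert 0 (insert q (bset π)) := by
    ext p
    simp only [good, Finset.mem_filter, Finset.mem_range, Finset.mem_insert, hw]
    constructor
    · exact fun h => h.2
    · intro h
      refine ⟨?_, h⟩
      rcases h with h | h | h
      · omega
      · omega
      · simp only [bset, Finset.mem_filter, Finset.mem_Icc] at h; omega
  have hqb : q ∉ bset π := by
    intro h
    simp only [bset, Finset.mem_filter, (hw q).2 rfl] at h
    have := word_le π (q + 1)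
    omega
  have h0 : 0 ∉ insert q (bset π) := by
    simp only [Finset.mem_insert, bset, Finset.mem_filter, Finset.mem_Icc]
    omega
  rw [hg, Finset.card_insert_of_notMem h0, Finset.card_insert_of_notMem hqb]
  rfl

set_option maxHeartbeats 1000000 in
theorem basc_ins {m : ℕ} (hm : 1 ≤ m) (p : Fin (m + 1)) (π : Equiv.Perm (Fin m)) :
    basc (ins p π) = if (p : ℕ) ∈ good π then basc π else basc π + 1 := by
  have hp := p.2
  have hmem : ∀ i, i ∈ bset (ins p π) ↔
      (i < p ∧ i ∈ bset π) ∨ (i = p ∧ 1 ≤ i ∧ word π p ≠ m) ∨ (p + 2 ≤ i ∧ i - 1 ∈ bset π) := by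
    intro i
    simp only [bset, Finset.mem_filter, Finset.mem_Icc, word_ins]
    have h1 := word_le π i
    have h2 := word_le π (i + 1)
    rcases lt_trichotomy i p with h | h | h
    · rw [if_pos (by omega), if_pos (by omega)]; omega
    · rw [if_pos (by omega), if_neg (by omega), if_pos (by omega), h]
      rw [h] at h1
      omega
    · rcases eq_or_ne i (p + 1) with h' | h'
      · rw [if_neg (by omega), if_pos h', if_neg (by omega), if_neg (by omega)]
        simp only [Nat.add_sub_cancel]
        omega
      · rw [if_neg (by omega), if_neg h', if_neg (by omega), if_neg (by omega)]
        simp only [Nat.add_sub_cancel]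
        rw [show i - 1 + 1 = i by omega]
        omega
  let g : ℕ → ℕ := fun i => if i ≤ p then i else i + 1
  have hginj : Function.Injective g := by
    intro i j h
    simp only [g] at h
    split_ifs at h <;> omega
  have hbb : basc (ins p π) = (bset (ins p π)).card := rfl
  have hb : basc π = (bset π).card := rfl
  have hpb : (p : ℕ) ∈ bset π → 1 ≤ (p : ℕ) ∧ word π p ≠ m := by
    intro h
    simp only [bset, Finset.mem_filter, Finset.mem_Icc] at h
    have := word_le π (p + 1)
    omega
  have himg : ∀ i, i ∈ (bset π).image g ↔
      (i ≤ p ∧ i ∈ bset π) ∨ (p + 2 ≤ i ∧ i - 1 ∈ bset π) := by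
    intro i
    simp only [Finset.mem_image, g]
    constructor
    · rintro ⟨k, hk, rfl⟩
      split_ifs with h
      · exact Or.inl ⟨h, hk⟩
      · right; exact ⟨by omega, by simpa using hk⟩
    · rintro (⟨h, hk⟩ | ⟨h, hk⟩)
      · exact ⟨i, hk, if_pos h⟩
      · exact ⟨i - 1, hk, by rw [if_neg (by omega)]; omega⟩
  rw [hbb, hb, ← Finset.card_image_of_injective (bset π) hginj]
  have hgood : (p : ℕ) ∈ good π ↔ ((p : ℕ) = 0 ∨ word π p = m ∨ (p : ℕ) ∈ bset π) := by
    simp only [good, Finset.mem_filter, Finset.mem_range]; tauto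
  split_ifs with h
  · rw [hgood] at h
    congr 1
    ext i
    rw [hmem, himg]
    have h0 : (0 : ℕ) ∉ bset π := by simp [bset]
    rcases eq_or_ne i p with hi | hi
    · subst hi
      have : ¬ ((p : ℕ) + 2 ≤ p) := by omega
      simp only [lt_irrefl, false_and, false_or, true_and, this, or_false, le_refl]
      refine ⟨fun h' => ?_, hpb⟩
      rcases h with h | h | h
      · omega
      · exact absurd h h'.2
      · exact h
    · have : i < p ↔ i ≤ p := by omega
      simp only [this, hi, false_and, false_or]
  · rw [hgood] at h
    push Not at h
    have hn : (p : ℕ) ∉ (bset π).image g := by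
      rw [himg]; rintro (h' | h')
      · exact h.2.2 h'.2
      · omega
    rw [← Finset.card_insert_of_notMem hn]
    congr 1
    ext i
    rw [Finset.mem_insert, hmem, himg]
    rcases eq_or_ne i p with hi | hi
    · subst hi
      have := h.1
      have := h.2.1
      simp only [true_or, iff_true]
      right; left
      exact ⟨trivial, by omega, h.2.1⟩
    · have : i < p ↔ i ≤ p := by omega
      simp only [this, hi, false_and, false_or]

theorem good_card_le {m : ℕ} (π : Equiv.Perm (Fin m)) : (good π).card ≤ m + 1 := by
  simpa [good] using Finset.card_filter_le (Finset.range (m + 1)) (fun p => p = 0 ∨ word π p = m ∨ p ∈ bset π)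

theorem basc_le {m : ℕ} (π : Equiv.Perm (Fin (m + 2))) : basc π ≤ m := by
  obtain ⟨⟨τ, p⟩, h⟩ := ins_bij.2 π
  dsimp only at h
  rw [← h, basc_ins (by omega)]
  have h1 := card_good (by omega) τ
  have h2 := good_card_le τ
  split_ifs with h3
  · omega
  · have : (good τ).card < (Finset.range (m + 1 + 1)).card := by
      apply Finset.card_lt_card
      refine ⟨Finset.filter_subset _ _, fun hs => h3 (hs (Finset.mem_range.2 p.2))⟩
    simp at this
    omega

noncomputable def B (m : ℕ) : ℝ[X] := ∑ π : Equiv.Perm (Fin m), X ^ basc π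

theorem B_succ (m : ℕ) (hm : 1 ≤ m) : B (m + 1) = T 2 (m - 1) (B m) := by
  have hT : T 2 (m - 1) (B m) = ∑ π : Equiv.Perm (Fin m), T 2 (m - 1) (X ^ basc π) := by
    simp only [B, T, derivative_sum, Finset.mul_sum, Finset.sum_add_distrib]
  rw [hT, B, ← ins_bij.sum_comp, Fintype.sum_prod_type]
  refine Finset.sum_congr rfl fun π _ => ?_
  have h1 : ∀ p : Fin (m + 1), (X : ℝ[X]) ^ basc (ins p π) =
      (fun p : ℕ => if p ∈ good π then (X : ℝ[X]) ^ basc π else X ^ (basc π + 1)) p := by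
    intro p
    rw [basc_ins hm]
    dsimp only
    split_ifs <;> rfl
  simp only [h1]
  rw [Fin.sum_univ_eq_sum_range
    (fun p : ℕ => if p ∈ good π then (X : ℝ[X]) ^ basc π else X ^ (basc π + 1)) (m + 1)]
  rw [Finset.sum_ite, Finset.sum_const, Finset.sum_const]
  have hf : (Finset.range (m + 1)).filter (fun p => p ∈ good π) = good π := by
    ext p; simp [good]
  have hc := Finset.card_filter_add_card_filter_not (s := Finset.range (m + 1)) (fun p => p ∈ good π)
  rw [hf, card_good hm, Finset.card_range] at hc
  rw [hf, card_good hm]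
  have hj : X * derivative (X ^ basc π : ℝ[X]) = C (basc π : ℝ) * X ^ basc π := by
    cases basc π with
    | zero => simp
    | succ k => rw [derivative_X_pow]; simp; ring
  have hc' : (((Finset.range (m + 1)).filter (fun p => ¬ p ∈ good π)).card : ℝ[X]) =
      (m : ℝ[X]) - 1 - (basc π : ℝ[X]) := by
    have : ((basc π + 2 + ((Finset.range (m + 1)).filter (fun p => ¬ p ∈ good π)).card : ℕ) : ℝ[X])
      = ((m + 1 : ℕ) : ℝ[X]) := by rw [hc]
    push_cast at this
    linear_combination this
  rw [nsmul_eq_mul, nsmul_eq_mul, hc', T]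
  simp only [map_sub, map_natCast, map_ofNat, map_one] at *
  push_cast
  linear_combination -(1 - X) * hj

theorem B_two : B 2 = C 2 := by
  have h : ∀ π : Equiv.Perm (Fin 2), basc π = 0 := fun π => Nat.le_zero.1 (basc_le (m := 0) π)
  simp [B, h, Fintype.card_perm]; rfl

theorem B_decomp (m : ℕ) : ∃ P Q : ℝ[X], B (m + 2) = P + Q ∧ Gam 0 m P ∧ Gam 1 m Q := by
  induction m with
  | zero =>
    refine ⟨C 2, 0, by rw [B_two, add_zero], ?_, Gam.zero⟩
    simpa using Gam.single (s := 0) (m := 0) 2 0 0 (by norm_num) rfl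
  | succ m ih =>
    obtain ⟨P, Q, h, hP, hQ⟩ := ih
    refine ⟨T 1 (m - (0 : ℕ) + 1) P, T 2 (m - (1 : ℕ) + 2) Q + P, ?_, hP.T 1 (by norm_num),
      (hQ.T 2 (by norm_num)).add hP.shift⟩
    rw [B_succ (m + 2) (by omega), h]
    simp only [T, derivative_add, map_sub, map_add, map_natCast, map_ofNat, map_one]
    push_cast
    ring

theorem coeff_B (m k : ℕ) : (B m).coeff k = bascCount m k := by
  simp only [B, finsetSum_coeff, coeff_X_pow, bascCount, Finset.card_filter]
  push_cast
  refine Finset.sum_congr rfl fun π _ => ?_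
  simp only [eq_comm]

theorem reflect_B (m : ℕ) (x : ℝ) :
    (reflect m (B (m + 2))).eval x = ∑ π : Equiv.Perm (Fin (m + 2)), x ^ (m - basc π) := by
  have : reflect m (B (m + 2)) = ∑ π : Equiv.Perm (Fin (m + 2)), X ^ (m - basc π) := by
    let φ : ℝ[X] →+ ℝ[X] := ⟨⟨fun f => reflect m f, by simp⟩, fun f g => reflect_add f g m⟩
    change φ (B (m + 2)) = _
    rw [B, map_sum]
    refine Finset.sum_congr rfl fun π _ => ?_
    change reflect m (X ^ basc π) = _
    rw [reflect_monomial, revAt_le (basc_le π)]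
  rw [this]; simp [eval_finsetSum]

end

/-- for `n ≥ 2`, the reciprocal `Σ_{π ∈ S_n} x^(n-2-basc(π))` of the big
ascent polynomial is bi-γ-positive, and consequently the coefficient sequence
`c_k = bascCount n k` of `B_n(x)` is spiral:
`c_{n-2} ≤ c_0 ≤ c_{n-3} ≤ c_1 ≤ ⋯ ≤ c_{⌊(n-2)/2⌋}`. -/
theorem statement11 (n : ℕ) (hn : 2 ≤ n) :
    (∃ a b : ℕ → ℝ, (∀ j, 0 ≤ a j) ∧ (∀ j, 0 ≤ b j) ∧
      ∀ x : ℝ,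
        (∑ π : Equiv.Perm (Fin n), x ^ (n - 2 - basc π)) =
          (∑ j ∈ Finset.range ((n - 2) / 2 + 1), a j * x ^ j * (1 + x) ^ (n - 2 - 2 * j)) +
            ∑ j ∈ Finset.range ((n - 3) / 2 + 1), b j * x ^ (j + 1) * (1 + x) ^ (n - 3 - 2 * j)) ∧
    (∀ k, 2 * k ≤ n - 2 → bascCount n (n - 2 - k) ≤ bascCount n k) ∧
    (∀ k, 2 * k + 1 ≤ n - 2 → bascCount n k ≤ bascCount n (n - 3 - k)) := by
  obtain ⟨m, rfl⟩ : ∃ m, n = m + 2 := ⟨n - 2, by omega⟩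
  obtain ⟨P, Q, h, hP, hQ⟩ := B_decomp m
  have rP := hP.reflect
  have rQ := hQ.reflect
  refine ⟨?_, ?_, ?_⟩
  · obtain ⟨a, ha, hax⟩ := hP.explicit
    obtain ⟨b, hb, hbx⟩ := hQ.explicit
    refine ⟨a, b, ha, hb, fun x => ?_⟩
    have h1 := reflect_B m x
    rw [h, Polynomial.reflect_add, rP, rQ] at h1
    simp only [Nat.add_sub_cancel]
    rw [← h1]
    simp only [Polynomial.eval_add, Polynomial.eval_mul, Polynomial.eval_pow, Polynomial.eval_X,
      hax, hbx, pow_zero, one_mul, pow_one, Nat.sub_zero, Finset.mul_sum]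
    congr 1
    rw [show m + 2 - 3 = m - 1 by omega]
    refine Finset.sum_congr rfl fun j _ => ?_
    ring
  · intro k hk
    simp only [Nat.add_sub_cancel] at hk ⊢
    have h2 : (bascCount (m + 2) (m - k) : ℝ) ≤ bascCount (m + 2) k := by
      rw [← coeff_B, ← coeff_B, h, Polynomial.coeff_add, Polynomial.coeff_add]
      have e1 := congrArg (fun f => Polynomial.coeff f k) rP
      have e2 := congrArg (fun f => Polynomial.coeff f k) rQ
      simp only [Polynomial.coeff_reflect, Polynomial.revAt_le (show k ≤ m by omega), pow_zero,
        one_mul, pow_one] at e1 e2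
      rw [e1, e2]
      refine add_le_add le_rfl ?_
      cases k with
      | zero =>
        rw [Polynomial.coeff_X_mul_zero]
        exact hQ.coeff_nonneg 0
      | succ k =>
        rw [Polynomial.coeff_X_mul]
        exact hQ.coeff_mono k (by omega)
    exact_mod_cast h2
  · intro k hk
    rw [show m + 2 - 3 - k = m - (k + 1) by omega]
    have h2 : (bascCount (m + 2) k : ℝ) ≤ bascCount (m + 2) (m - (k + 1)) := by
      rw [← coeff_B, ← coeff_B, h, Polynomial.coeff_add, Polynomial.coeff_add]
      have e1 := congrArg (fun f => Polynomial.coeff f (k + 1)) rP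
      have e2 := congrArg (fun f => Polynomial.coeff f (k + 1)) rQ
      simp only [Polynomial.coeff_reflect, Polynomial.revAt_le (show k + 1 ≤ m by omega), pow_zero,
        one_mul, pow_one, Polynomial.coeff_X_mul] at e1 e2
      rw [e1, e2]
      exact add_le_add (hP.coeff_mono k (by omega)) le_rfl
    exact_mod_cast h2

end SucEuler
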